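/- arXiv:1205.0503 — 2 statements merged into one kernel-verified Lean document; each statement's English description precedes it below -/
import Mathlib

section
/- Let n be a positive integer, S ⊆ ℤ_n \ {0} with S = -S, and suppose Circ(n;S) is connected (i.e. ⟨S⟩ = ℤ_n). Let α be a graph automorphism of Circ(n;S) that respects the partition 𝒞 and fixes the vertex 0. Then there exists an integer j coprime to n such that α(a·s) = j·a·s in ℤ_n for every integer a and every s ∈ S, and multiplication by j maps S onto S. -/
/-- The circulant graph `Circ(n; S)`: vertices are `ZMod n`, with `g ~ h` iff `h - g ∈ S`
(given that `S` is symmetric and does not contain `0`). -/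
def Circ (n : ℕ) (S : Set (ZMod n)) : SimpleGraph (ZMod n) :=
  SimpleGraph.fromRel (fun g h => h - g ∈ S)

/-- The part of the partition `𝒞` determined by the connection-set element `s` and the
coset `x + ⟨s⟩`: the set of edges `{g, g+s}` with `g ∈ x + ⟨s⟩`. -/
def cyclePart {n : ℕ} (s x : ZMod n) : Set (Sym2 (ZMod n)) :=
  {e | ∃ g : ZMod n, g - x ∈ AddSubgroup.zmultiples s ∧ e = s(g, g + s)}

/-- A vertex map `f` respects the partition `𝒞` if the image of every part of `𝒞`
is again a part of `𝒞`. -/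
def RespectsC {n : ℕ} (S : Set (ZMod n)) (f : ZMod n → ZMod n) : Prop :=
  ∀ s ∈ S, ∀ x : ZMod n, ∃ s' ∈ S, ∃ x' : ZMod n,
    Sym2.map f '' cyclePart s x = cyclePart s' x'

theorem aux_gcd_lcm (a b c : ℕ) (ha : a ≠ 0) (hb : b ≠ 0) (hc : c ≠ 0) :
    Nat.gcd (Nat.lcm a b) c = Nat.lcm (Nat.gcd a c) (Nat.gcd b c) := by
  have h1 : Nat.gcd a c ≠ 0 := Nat.gcd_ne_zero_left ha
  have h2 : Nat.gcd b c ≠ 0 := Nat.gcd_ne_zero_left hb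
  apply Nat.eq_of_factorization_eq (Nat.gcd_ne_zero_right hc) (Nat.lcm_ne_zero h1 h2)
  intro p
  rw [Nat.factorization_gcd (Nat.lcm_ne_zero ha hb) hc, Nat.factorization_lcm ha hb,
    Nat.factorization_lcm h1 h2, Nat.factorization_gcd ha hc, Nat.factorization_gcd hb hc]
  simp only [Finsupp.inf_apply, Finsupp.sup_apply]
  exact inf_sup_right _ _ _

theorem aux_crt2 (L c : ℕ) (j r : ℤ) (h : ((Nat.gcd L c : ℕ) : ℤ) ∣ r - j) :
    ∃ k : ℤ, (L : ℤ) ∣ k - j ∧ (c : ℤ) ∣ k - r := by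
  obtain ⟨q, hq⟩ := h
  have hb := Nat.gcd_eq_gcd_ab L c
  refine ⟨j + L * (Nat.gcdA L c * q), ⟨Nat.gcdA L c * q, by ring⟩, ⟨- (Nat.gcdB L c * q), ?_⟩⟩
  rw [hb] at hq
  linear_combination -hq

theorem aux_crt {ι : Type*} [DecidableEq ι] (m : ι → ℕ) (r : ι → ℤ) (hm : ∀ i, m i ≠ 0)
    (T : Finset ι) (h : ∀ i ∈ T, ∀ k ∈ T, ((Nat.gcd (m i) (m k) : ℕ) : ℤ) ∣ r i - r k) :
    ∃ (L : ℕ) (j : ℤ), L ≠ 0 ∧ (∀ i ∈ T, m i ∣ L) ∧ (∀ i ∈ T, (m i : ℤ) ∣ j - r i) ∧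
      ∀ (c : ℕ) (x : ℤ), c ≠ 0 → (∀ i ∈ T, ((Nat.gcd (m i) c : ℕ) : ℤ) ∣ x) →
        ((Nat.gcd L c : ℕ) : ℤ) ∣ x := by
  induction T using Finset.induction_on with
  | empty => exact ⟨1, 0, by simp, by simp, by simp, by simp⟩
  | insert t T ht ih =>
    obtain ⟨L, j, hL, hmL, hj, hg⟩ := ih (fun i hi k hk =>
      h i (Finset.mem_insert_of_mem hi) k (Finset.mem_insert_of_mem hk))
    have key : ((Nat.gcd L (m t) : ℕ) : ℤ) ∣ r t - j := by
      apply hg _ _ (hm t)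
      intro i hi
      have h1 := h t (Finset.mem_insert_self _ _) i (Finset.mem_insert_of_mem hi)
      have h2 : ((Nat.gcd (m i) (m t) : ℕ) : ℤ) ∣ j - r i :=
        (Int.natCast_dvd_natCast.2 (Nat.gcd_dvd_left _ _)).trans (hj i hi)
      rw [Nat.gcd_comm] at h1
      have := dvd_sub h1 h2
      rwa [show r t - r i - (j - r i) = r t - j by ring] at this
    obtain ⟨k, hk1, hk2⟩ := aux_crt2 L (m t) j (r t) key
    refine ⟨Nat.lcm L (m t), k, Nat.lcm_ne_zero hL (hm t), ?_, ?_, ?_⟩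
    · intro i hi
      rcases Finset.mem_insert.1 hi with rfl | hi
      · exact Nat.dvd_lcm_right _ _
      · exact (hmL i hi).trans (Nat.dvd_lcm_left _ _)
    · intro i hi
      rcases Finset.mem_insert.1 hi with rfl | hi
      · exact hk2
      · have := dvd_add ((Int.natCast_dvd_natCast.2 (hmL i hi)).trans hk1) (hj i hi)
        rwa [show k - j + (j - r i) = k - r i by ring] at this
    · intro c x hc hx
      rw [aux_gcd_lcm _ _ _ hL (hm t) hc]
      have h1 := hg c x hc (fun i hi => hx i (Finset.mem_insert_of_mem hi))
      have h2 := hx t (Finset.mem_insert_self _ _)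
      rw [Int.natCast_dvd] at *
      exact Nat.lcm_dvd h1 h2

theorem aux_mem (n : ℕ) (hn : 0 < n) (s t : ZMod n) (h : addOrderOf s = addOrderOf t) :
    ∃ c : ℤ, t = c • s := by
  have : NeZero n := ⟨hn.ne'⟩
  obtain ⟨a, rfl⟩ := ZMod.natCast_zmod_surjective s
  obtain ⟨b, rfl⟩ := ZMod.natCast_zmod_surjective t
  rw [ZMod.addOrderOf_coe a hn.ne', ZMod.addOrderOf_coe b hn.ne'] at h
  have hg : n.gcd a = n.gcd b := by
    have h1 := Nat.div_mul_cancel (Nat.gcd_dvd_left n a)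
    have h2 := Nat.div_mul_cancel (Nat.gcd_dvd_left n b)
    rw [← h] at h2
    have h3 : 0 < n / n.gcd a :=
      Nat.div_pos (Nat.le_of_dvd hn (Nat.gcd_dvd_left n a)) (Nat.gcd_pos_of_pos_left _ hn)
    exact Nat.eq_of_mul_eq_mul_left h3 (h1.trans h2.symm)
  obtain ⟨q, hq⟩ : n.gcd a ∣ b := hg ▸ Nat.gcd_dvd_right n b
  have hb := congrArg (Int.cast : ℤ → ZMod n) (Nat.gcd_eq_gcd_ab n a)
  push_cast at hb
  rw [ZMod.natCast_self] at hb
  refine ⟨q * Nat.gcdB n a, ?_⟩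
  have hq' := congrArg (Nat.cast : ℕ → ZMod n) hq
  push_cast at hq'
  rw [zsmul_eq_mul, hq', hb]
  push_cast
  ring

theorem aux_cycle (n : ℕ) (f : ZMod n → ZMod n) (hf : Function.Injective f) (h0 : f 0 = 0)
    (s s' x' : ZMod n) (h : Sym2.map f '' cyclePart s 0 = cyclePart s' x') (a : ℤ) :
    f (a • s) = a • f s := by
  have hd : ∀ a : ℤ, f (a • s + s) - f (a • s) = s' ∨ f (a • s + s) - f (a • s) = -s' := by
    intro a
    have : Sym2.map f s(a • s, a • s + s) ∈ cyclePart s' x' := by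
      rw [← h]
      exact ⟨_, ⟨a • s, by simp, rfl⟩, rfl⟩
    obtain ⟨g, -, hg⟩ := this
    rw [Sym2.map_mk, Sym2.eq_iff] at hg
    rcases hg with ⟨h1, h2⟩ | ⟨h1, h2⟩
    · left; rw [h1, h2]; ring
    · right; rw [h1, h2]; ring
  have h2s : s + s = 0 → s' = -s' := by
    intro hs
    have hone : ∀ e ∈ cyclePart s (0 : ZMod n), e = s(0, s) := by
      rintro e ⟨g, hg, rfl⟩
      rw [sub_zero, AddSubgroup.mem_zmultiples_iff] at hg
      obtain ⟨k, rfl⟩ := hg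
      have h2 : (2 : ℤ) • s = 0 := by rw [two_zsmul, hs]
      rcases Int.even_or_odd' k with ⟨l, rfl | rfl⟩
      · have : (2 * l) • s = 0 := by rw [mul_comm, mul_zsmul, h2, smul_zero]
        rw [this, zero_add]
      · have : (2 * l + 1) • s = s := by
          rw [add_zsmul, mul_comm, mul_zsmul, h2, smul_zero, one_zsmul, zero_add]
        rw [this, hs, Sym2.eq_swap]
    have hone' : ∀ e ∈ cyclePart s' x', e = Sym2.map f s(0, s) := by
      rw [← h]
      rintro e ⟨e', he', rfl⟩
      rw [hone e' he']
    have e1 := hone' s(x', x' + s') ⟨x', by simp, rfl⟩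
    have e2 := hone' s(x' + s', x' + s' + s') ⟨x' + s', by simp, rfl⟩
    have e3 := e1.trans e2.symm
    rw [Sym2.eq_iff] at e3
    rcases e3 with ⟨h1, -⟩ | ⟨h1, -⟩
    · have : s' = 0 := by simpa using h1
      simp [this]
    · linear_combination -h1
  have hstep : ∀ a : ℤ, f ((a + 1) • s + s) - f ((a + 1) • s) = f (a • s + s) - f (a • s) := by
    intro a
    have ha : (a + 1) • s = a • s + s := by rw [add_zsmul, one_zsmul]
    have hneg : f ((a + 1) • s + s) - f ((a + 1) • s) = - (f (a • s + s) - f (a • s)) →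
        s' = -s' := by
      intro he
      rw [ha] at he
      have : f (a • s + s + s) = f (a • s) := by linear_combination he
      apply h2s
      have := hf this
      linear_combination this
    rcases hd a with h1 | h1 <;> rcases hd (a + 1) with h2 | h2
    · rw [h1, h2]
    · have := hneg (by rw [h1, h2])
      rw [h1, h2, ← this]
    · have := hneg (by rw [h1, h2, neg_neg])
      rw [h1, h2, ← this]
    · rw [h1, h2]
  have hconst : ∀ a : ℤ, f (a • s + s) - f (a • s) = f s := by
    intro a
    induction a using Int.induction_on with
    | zero => simp [h0]
    | succ i ih => rw [hstep, ih]
    | pred i ih =>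
      have := hstep (-(i : ℤ) - 1)
      rw [sub_add_cancel] at this
      rw [← this, ih]
  induction a using Int.induction_on with
  | zero => simp [h0]
  | succ i ih =>
    have := hconst i
    rw [add_zsmul, one_zsmul, add_zsmul, one_zsmul, ← ih]
    linear_combination this
  | pred i ih =>
    have := hconst (-(i : ℤ) - 1)
    rw [← one_zsmul s, ← mul_zsmul, ← add_zsmul, mul_one, sub_add_cancel, one_zsmul, ih] at this
    have h3 : (-(i : ℤ) - 1) • f s = -(i : ℤ) • f s - f s := by
      rw [zsmul_eq_mul, zsmul_eq_mul]; push_cast; ring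
    rw [h3]
    linear_combination -this

theorem exists_multiplier (n : ℕ) (hn : 0 < n) (S : Set (ZMod n))
    (h0S : (0 : ZMod n) ∉ S) (hSsym : S = -S)
    (hconn : AddSubgroup.closure S = ⊤)
    (α : Circ n S ≃g Circ n S) (hα0 : α 0 = 0) (hC : RespectsC S ⇑α) :
    ∃ j : ℤ, Int.gcd j n = 1 ∧
      (∀ (a : ℤ), ∀ s ∈ S, α (a • s) = (j : ZMod n) * (a • s)) ∧
      (fun x : ZMod n => (j : ZMod n) * x) '' S = S := by
  have : NeZero n := ⟨hn.ne'⟩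
  have hneg : ∀ s ∈ S, -s ∈ S := by
    intro s hs
    rw [hSsym] at hs
    exact hs
  have hadj : ∀ s, (Circ n S).Adj 0 s ↔ s ∈ S := by
    intro s
    rw [Circ, SimpleGraph.fromRel_adj]
    constructor
    · rintro ⟨-, h | h⟩
      · simpa using h
      · simpa using hneg _ h
    · intro h
      refine ⟨?_, Or.inl (by simpa using h)⟩
      rintro rfl
      exact h0S h
  have hαS : ∀ s, α s ∈ S ↔ s ∈ S := by
    intro s
    rw [← hadj, ← hadj]
    conv_lhs => rw [← hα0]
    exact α.map_adj_iff
  have hinj : Function.Injective α := α.injective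
  have hlin : ∀ s ∈ S, ∀ a : ℤ, α (a • s) = a • α s := by
    intro s hs a
    obtain ⟨s', -, x', h⟩ := hC s hs 0
    exact aux_cycle n α hinj hα0 s s' x' h a
  have hord : ∀ s ∈ S, addOrderOf s = addOrderOf (α s) := by
    intro s hs
    apply Nat.dvd_antisymm
    · apply addOrderOf_dvd_of_nsmul_eq_zero
      have := hlin s hs (addOrderOf (α s))
      rw [natCast_zsmul, natCast_zsmul, addOrderOf_nsmul_eq_zero] at this
      exact hinj (this.trans hα0.symm)
    · apply addOrderOf_dvd_of_nsmul_eq_zero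
      have := hlin s hs (addOrderOf s)
      rw [natCast_zsmul, natCast_zsmul, addOrderOf_nsmul_eq_zero] at this
      exact this.symm.trans hα0
  have hr : ∀ s : ZMod n, ∃ c : ℤ, s ∈ S → α s = c • s := by
    intro s
    by_cases hs : s ∈ S
    · obtain ⟨c, hc⟩ := aux_mem n hn s (α s) (hord s hs)
      exact ⟨c, fun _ => hc⟩
    · exact ⟨0, fun h => absurd h hs⟩
  choose r hr using hr
  have hm : ∀ s : ZMod n, addOrderOf s ≠ 0 := fun s => (addOrderOf_pos s).ne'
  have hmul : ∀ s ∈ S, ∀ a : ℤ, α (a • s) = r s • (a • s) := by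
    intro s hs a
    rw [hlin s hs, hr s hs, ← mul_zsmul, ← mul_zsmul, mul_comm]
  have hcomp : ∀ s ∈ S, ∀ t ∈ S,
      ((Nat.gcd (addOrderOf s) (addOrderOf t) : ℕ) : ℤ) ∣ r s - r t := by
    intro s hs t ht
    set g := Nat.gcd (addOrderOf s) (addOrderOf t) with hg
    have hgs : g ∣ addOrderOf s := Nat.gcd_dvd_left _ _
    have hgt : g ∣ addOrderOf t := Nat.gcd_dvd_right _ _
    have o1 : addOrderOf ((addOrderOf s / g) • s) = g :=
      addOrderOf_nsmul_addOrderOf_sub (hm s) hgs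
    have o2 : addOrderOf ((addOrderOf t / g) • t) = g :=
      addOrderOf_nsmul_addOrderOf_sub (hm t) hgt
    obtain ⟨c, hc⟩ := aux_mem n hn _ _ (o1.trans o2.symm)
    have e1 := hmul t ht ((addOrderOf t / g : ℕ) : ℤ)
    rw [natCast_zsmul] at e1
    have e2 := hmul s hs (c * ((addOrderOf s / g : ℕ) : ℤ))
    rw [mul_zsmul, natCast_zsmul, ← hc, e1] at e2
    rw [← o2, addOrderOf_dvd_iff_zsmul_eq_zero, sub_zsmul, e2, add_neg_cancel]
  classical
  obtain ⟨L, j, -, -, hj, -⟩ := aux_crt (fun s : ZMod n => addOrderOf s) r hm S.toFinset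
    (by simpa using hcomp)
  have hj' : ∀ s ∈ S, j • s = r s • s := by
    intro s hs
    have := hj s (by simpa using hs)
    rw [addOrderOf_dvd_iff_zsmul_eq_zero, sub_zsmul] at this
    exact add_neg_eq_zero.1 this
  have hjα : ∀ s ∈ S, (j : ZMod n) * s = α s := by
    intro s hs
    rw [← zsmul_eq_mul, hj' s hs, hr s hs]
  have himg : (fun x : ZMod n => (j : ZMod n) * x) '' S = S := by
    ext y
    constructor
    · rintro ⟨s, hs, rfl⟩
      simp only [hjα s hs]
      exact (hαS s).2 hs
    · intro hy
      have : α (α.symm y) = y := α.apply_symm_apply y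
      have hs : α.symm y ∈ S := by rw [← hαS, this]; exact hy
      exact ⟨_, hs, (hjα _ hs).trans this⟩
  refine ⟨j, ?_, ?_, himg⟩
  · have hsurj : ∀ x ∈ AddSubgroup.closure S, ∃ y, (j : ZMod n) * y = x := by
      intro x hx
      induction hx using AddSubgroup.closure_induction with
      | mem x hx =>
        rw [← himg] at hx
        obtain ⟨y, -, hy⟩ := hx
        exact ⟨y, hy⟩
      | zero => exact ⟨0, mul_zero _⟩
      | add x y _ _ hx hy =>
        obtain ⟨a, rfl⟩ := hx
        obtain ⟨b, rfl⟩ := hy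
        exact ⟨a + b, mul_add _ _ _⟩
      | neg x _ hx =>
        obtain ⟨a, rfl⟩ := hx
        exact ⟨-a, mul_neg _ _⟩
    obtain ⟨y, hy⟩ := hsurj 1 (by rw [hconn]; trivial)
    obtain ⟨b, rfl⟩ := ZMod.intCast_surjective y
    have h1 : ((j * b - 1 : ℤ) : ZMod n) = 0 := by push_cast; rw [hy, sub_self]
    rw [ZMod.intCast_zmod_eq_zero_iff_dvd] at h1
    obtain ⟨q, hq⟩ := h1
    rw [← Int.isCoprime_iff_gcd_eq_one]
    exact ⟨b, -q, by linear_combination hq⟩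
  · intro a s hs
    rw [hlin s hs, ← hjα s hs, zsmul_eq_mul, zsmul_eq_mul]
    ring
end

section
/- Let n be a positive integer, S ⊆ ℤ_n \ {0} with S = -S, and suppose Circ(n;S) is connected (i.e. ⟨S⟩ = ℤ_n). Let α be a graph automorphism of Circ(n;S) that fixes the vertex 0 and respects the partition 𝒞. Then α also respects the coarser partition ℬ. -/
/-- The part of the coarser partition `ℬ` determined by the connection-set element `s`:
the set of all edges `{g, g+s}` with `g ∈ ZMod n`. -/
def linePart {n : ℕ} (s : ZMod n) : Set (Sym2 (ZMod n)) :=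
  {e | ∃ g : ZMod n, e = s(g, g + s)}

lemma mem_zm {n : ℕ} [NeZero n] (u t : ZMod n) (h : addOrderOf t • u = 0) :
    u ∈ AddSubgroup.zmultiples t := by
  classical
  have h1 : (AddSubgroup.zmultiples t : Set (ZMod n)).toFinset ⊆
      Finset.univ.filter (fun a : ZMod n => addOrderOf t • a = 0) := by
    intro a ha
    simp only [Set.mem_toFinset, SetLike.mem_coe, AddSubgroup.mem_zmultiples_iff] at ha
    obtain ⟨k, rfl⟩ := ha
    simp only [Finset.mem_filter, Finset.mem_univ, true_and]
    rw [smul_comm, addOrderOf_nsmul_eq_zero, smul_zero]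
  have h2 := Finset.eq_of_subset_of_card_le h1 (by
    refine (IsAddCyclic.card_nsmul_eq_zero_le (α := ZMod n) (addOrderOf_pos t)).trans ?_
    rw [Set.toFinset_card, ← Nat.card_eq_fintype_card]
    exact (Nat.card_zmultiples t).ge)
  have h3 : u ∈ Finset.univ.filter (fun a : ZMod n => addOrderOf t • a = 0) := by simpa using h
  rw [← h2] at h3
  simpa using h3

lemma key {n : ℕ} [NeZero n] (f : ZMod n → ZMod n) (s t : ZMod n)
    (hs : ∀ x, f (x + s + s) - f (x + s) = f (x + s) - f x)
    (ht : ∀ x, f (x + t + t) - f (x + t) = f (x + t) - f x) (x : ZMod n) :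
    f (x + t + s) - f (x + t) = f (x + s) - f x := by
  have gen : ∀ s : ZMod n, (∀ x, f (x + s + s) - f (x + s) = f (x + s) - f x) →
      ∀ x, ∀ k : ℕ, f (x + k • s + s) - f (x + k • s) = f (x + s) - f x ∧
        f (x + k • s) = f x + k • (f (x + s) - f x) := by
    intro s hs x k
    induction k with
    | zero => simp
    | succ k ih =>
      have e : x + (k + 1) • s = x + k • s + s := by rw [succ_nsmul, add_assoc]
      rw [e]
      refine ⟨(hs _).trans ih.1, ?_⟩
      rw [succ_nsmul, ← add_assoc, ← ih.2, ← ih.1]; abel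
  have half : ∀ s t : ZMod n, (∀ x, f (x + s + s) - f (x + s) = f (x + s) - f x) →
      (∀ x, f (x + t + t) - f (x + t) = f (x + t) - f x) →
      (addOrderOf s / Nat.gcd (addOrderOf s) (addOrderOf t)) •
        ((f (x + t + s) - f (x + t)) - (f (x + s) - f x)) = 0 := by
    intro s t hs ht
    set k := addOrderOf s / Nat.gcd (addOrderOf s) (addOrderOf t) with hk
    have hm : k • s ∈ AddSubgroup.zmultiples t := by
      apply mem_zm
      rw [← mul_nsmul', ← addOrderOf_dvd_iff_nsmul_eq_zero, hk,
        ← Nat.mul_div_assoc _ (Nat.gcd_dvd_left _ _), mul_comm,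
        Nat.mul_div_assoc _ (Nat.gcd_dvd_right _ _)]
      exact dvd_mul_right _ _
    rw [mem_zmultiples_iff_mem_range_addOrderOf] at hm
    simp only [Finset.mem_image] at hm
    obtain ⟨j, -, hj⟩ := hm
    have a1 := (gen t ht x j).1
    simp only [hj] at a1
    have a2 := (gen s hs x k).2
    have a3 := (gen s hs (x + t) k).2
    rw [add_right_comm] at a3
    rw [nsmul_sub]
    rw [a3, a2] at a1
    linear_combination a1
  have h1 := half s t hs ht
  have h2 := half t s ht hs
  rw [add_right_comm x s t] at h2
  have e : f (x + t + s) - f (x + s) - (f (x + t) - f x) =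
    f (x + t + s) - f (x + t) - (f (x + s) - f x) := by abel
  rw [e, Nat.gcd_comm] at h2
  rw [← addOrderOf_dvd_iff_nsmul_eq_zero] at h1 h2
  have h3 := Nat.dvd_gcd h1 h2
  rw [Nat.Coprime.gcd_eq_one (Nat.coprime_div_gcd_div_gcd (Nat.gcd_pos_of_pos_left _ (addOrderOf_pos s))),
    Nat.dvd_one, AddMonoid.addOrderOf_eq_one_iff] at h3
  exact sub_eq_zero.mp h3

lemma step {n : ℕ} (S : Set (ZMod n)) (f : ZMod n → ZMod n) (hf : Function.Injective f)
    (hC : RespectsC S f) (s : ZMod n) (hs : s ∈ S) (x : ZMod n) :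
    f (x + s + s) - f (x + s) = f (x + s) - f x := by
  obtain ⟨s', -, x', h⟩ := hC s hs x
  have m1 : s(f x, f (x + s)) ∈ cyclePart s' x' := by
    rw [← h]; exact ⟨s(x, x + s), ⟨x, by simp, rfl⟩, rfl⟩
  have m2 : s(f (x + s), f (x + s + s)) ∈ cyclePart s' x' := by
    rw [← h]; exact ⟨s(x + s, x + s + s), ⟨x + s, by simp, rfl⟩, rfl⟩
  have fin : f x = f (x + s + s) → f (x + s + s) - f (x + s) = f (x + s) - f x := by
    intro e
    have hss : s + s = 0 := by
      have := hf e
      rw [add_assoc] at this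
      simpa using this.symm
    obtain ⟨g, hg, hge⟩ := m1
    have m3 : s(g + s', g + s' + s') ∈ cyclePart s' x' := by
      refine ⟨g + s', ?_, rfl⟩
      have := AddSubgroup.add_mem _ hg (AddSubgroup.mem_zmultiples s')
      rwa [sub_add_eq_add_sub] at this
    have all : ∀ e ∈ cyclePart s' x', e = s(f x, f (x + s)) := by
      rw [← h]
      rintro _ ⟨_, ⟨y, hy, rfl⟩, rfl⟩
      obtain ⟨k, hk⟩ := AddSubgroup.mem_zmultiples_iff.mp hy
      have hk' : y = x + k • s := by rw [hk]; abel
      subst hk'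
      rcases Int.even_or_odd' k with ⟨c, rfl | rfl⟩
      · have : (2 * c) • s = 0 := by
          rw [mul_comm, mul_zsmul, two_zsmul, hss, smul_zero]
        rw [this]; simp
      · have : (2 * c + 1) • s = s := by
          rw [add_zsmul, mul_comm, mul_zsmul, two_zsmul, hss, smul_zero]; simp
        rw [this, Sym2.map_mk, add_assoc x s s, hss, add_zero]
        exact Sym2.eq_swap
    have m4 := (all _ m3).trans hge
    have ds : s' + s' = 0 := by
      rcases Sym2.eq_iff.mp m4 with ⟨a, b⟩ | ⟨a, b⟩
      · have : s' = 0 := by simpa using a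
        simp [this]
      · rw [add_assoc] at b; simpa using b
    rw [← e]
    rcases Sym2.eq_iff.mp hge with ⟨a, b⟩ | ⟨a, b⟩ <;> rw [a, b]
    · linear_combination -ds
    · linear_combination ds
  obtain ⟨g, -, hg⟩ := m1
  obtain ⟨g', -, hg'⟩ := m2
  rcases Sym2.eq_iff.mp hg with ⟨a, b⟩ | ⟨a, b⟩ <;>
  rcases Sym2.eq_iff.mp hg' with ⟨c, d⟩ | ⟨c, d⟩
  · linear_combination d - c - b + a
  · exact fin (by linear_combination a - b + c - d)
  · exact fin (by linear_combination a - b + c - d)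
  · linear_combination d - c - b + a

theorem respects_B (n : ℕ) (hn : 0 < n) (S : Set (ZMod n))
    (h0S : (0 : ZMod n) ∉ S) (hSsym : S = -S)
    (hconn : AddSubgroup.closure S = ⊤)
    (α : Circ n S ≃g Circ n S) (hα0 : α 0 = 0) (hC : RespectsC S ⇑α) :
    ∀ s ∈ S, ∃ s' ∈ S, Sym2.map ⇑α '' linePart s = linePart s' := by
  have : NeZero n := ⟨hn.ne'⟩
  have hst := step S α α.injective hC
  intro s hs
  have hinv : ∀ t x, α (x + t + s) - α (x + t) = α (x + s) - α x := by
    intro t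
    have ht : t ∈ AddSubgroup.closure S := by rw [hconn]; trivial
    induction ht using AddSubgroup.closure_induction with
    | mem t ht => exact fun x => key α s t (hst s hs) (hst t ht) x
    | zero => simp
    | add a b _ _ ha hb =>
      intro x
      rw [← add_assoc, hb, ha]
    | neg a _ ha =>
      intro x
      have := ha (x + -a)
      rw [neg_add_cancel_right] at this
      exact this.symm
  have hlin : ∀ x, α (x + s) = α x + α s := by
    intro x
    have := hinv x 0
    simp only [zero_add, hα0, sub_zero] at this
    rw [← this]; abel
  refine ⟨α s, ?_, ?_⟩
  · have hs0 : (0 : ZMod n) ≠ s := fun h => h0S (h ▸ hs)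
    have : (Circ n S).Adj 0 s := by
      simp [Circ, SimpleGraph.fromRel_adj, hs0, hs]
    have := α.map_adj_iff.mpr this
    rw [hα0] at this
    simp only [Circ, SimpleGraph.fromRel_adj, sub_zero, zero_sub] at this
    rcases this.2 with h | h
    · exact h
    · exact (Set.ext_iff.mp hSsym _).mpr h
  · ext e
    constructor
    · rintro ⟨_, ⟨g, rfl⟩, rfl⟩
      exact ⟨α g, by rw [Sym2.map_mk, hlin]⟩
    · rintro ⟨g, rfl⟩
      refine ⟨_, ⟨α.symm g, rfl⟩, ?_⟩
      rw [Sym2.map_mk, hlin]; simp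
end
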